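/- Let V : (0,∞) → ℝ be three times continuously differentiable, and for an integer ℓ ≥ 0 and C > 0 define 𝕍_ℓ^C(x) := sup_{y ∈ (x,C)} |V^{(ℓ)}(y)|. Assume that x ↦ x³·𝕍₃¹(x) is Lebesgue integrable on (0,1). Then: (i) x ↦ x^k V^{(k)}(x) is Lebesgue integrable on (0,1) for k = 0, 1, 2; (ii) for every C > 0 and every k ∈ {0, 1, 2}, x^{k+1}·𝕍_k^C(x) → 0 as x → 0⁺; and (iii) x · ∫_x^1 y·𝕍₂¹(y) dy → 0 as x → 0⁺. -/

import Mathlib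

/-- `supAbsOn g s = sup_{y ∈ s} |g y|` (as a real `sSup`). -/
noncomputable def supAbsOn (g : ℝ → ℝ) (s : Set ℝ) : ℝ :=
  sSup ((fun y : ℝ => |g y|) '' s)

open MeasureTheory Set Filter Topology

lemma supAbsOn_nonneg (g : ℝ → ℝ) (s : Set ℝ) : 0 ≤ supAbsOn g s := by
  refine Real.sSup_nonneg ?_
  rintro _ ⟨y, -, rfl⟩
  exact abs_nonneg _

lemma supAbsOn_le {g : ℝ → ℝ} {s : Set ℝ} {B : ℝ} (hB : 0 ≤ B) (h : ∀ y ∈ s, |g y| ≤ B) :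
    supAbsOn g s ≤ B := by
  refine Real.sSup_le ?_ hB
  rintro _ ⟨y, hy, rfl⟩
  exact h y hy

lemma abs_le_supAbsOn_Ioo {g : ℝ → ℝ} (hg : ContinuousOn g (Ioi 0)) {x C y : ℝ} (hx : 0 < x)
    (hy : y ∈ Ioo x C) : |g y| ≤ supAbsOn g (Ioo x C) := by
  have hc : ContinuousOn (fun y => |g y|) (Icc x C) :=
    (hg.mono fun z hz => hx.trans_le hz.1).abs
  exact le_csSup ((isCompact_Icc.bddAbove_image hc).mono (image_mono Ioo_subset_Icc_self))
    ⟨y, hy, rfl⟩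

lemma abs_left_le_supAbsOn_Ioo {g : ℝ → ℝ} (hg : ContinuousOn g (Ioi 0)) {x C : ℝ} (hx : 0 < x)
    (hxC : x < C) : |g x| ≤ supAbsOn g (Ioo x C) := by
  have hlim : Tendsto (fun y => |g y|) (𝓝[>] x) (𝓝 |g x|) :=
    ((hg.continuousAt (Ioi_mem_nhds hx)).tendsto.mono_left nhdsWithin_le_nhds).abs
  refine le_of_tendsto hlim ?_
  filter_upwards [Ioo_mem_nhdsGT hxC] with y hy using abs_le_supAbsOn_Ioo hg hx hy

lemma supAbsOn_Ioo_antitoneOn {g : ℝ → ℝ} (hg : ContinuousOn g (Ioi 0)) (C : ℝ) :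
    AntitoneOn (fun x => supAbsOn g (Ioo x C)) (Ioi 0) := fun _ hx _ _ hxy =>
  supAbsOn_le (supAbsOn_nonneg _ _) fun _ hz =>
    abs_le_supAbsOn_Ioo hg hx ⟨hxy.trans_lt hz.1, hz.2⟩

lemma integrableOn_tail_integral {h : ℝ → ℝ} (hc : ContinuousOn h (Ioi 0))
    (hi : IntegrableOn (fun y => y * h y) (Ioo 0 1)) :
    IntegrableOn (fun x => ∫ y in Ioo x 1, |h y|) (Ioo 0 1) := by
  set μ := (volume : Measure ℝ).restrict (Ioo 0 1) with hμ
  set φ : ℝ × ℝ → ℝ := {p : ℝ × ℝ | p.1 < p.2}.indicator (fun p => |h p.2|) with hφ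
  have hmeas : AEStronglyMeasurable h μ :=
    (hc.mono Ioo_subset_Ioi_self).aestronglyMeasurable measurableSet_Ioo
  have hφm : AEStronglyMeasurable φ (μ.prod μ) :=
    (hmeas.comp_snd (μ := μ)).norm.indicator (measurableSet_lt measurable_fst measurable_snd)
  have hsec : ∀ y, (fun x => φ (x, y)) = (Iio y).indicator fun _ => |h y| := by
    intro y; ext x; simp [hφ, indicator]
  have hφi : Integrable φ (μ.prod μ) := by
    rw [integrable_prod_iff' hφm]
    constructor
    · refine Eventually.of_forall fun y => ?_
      rw [hsec]
      exact (integrable_const _).indicator measurableSet_Iio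
    · refine hi.norm.congr ?_
      filter_upwards [ae_restrict_mem measurableSet_Ioo] with y hy
      have : (fun x => ‖φ (x, y)‖) = (Iio y).indicator fun _ => |h y| := by
        ext x; simp [hφ, indicator]; split_ifs <;> simp
      rw [this, integral_indicator measurableSet_Iio, hμ, Measure.restrict_restrict
        measurableSet_Iio, show Iio y ∩ Ioo 0 1 = Ioo 0 y by
          ext z; simp only [mem_inter_iff, mem_Iio, mem_Ioo]; grind]
      simp [abs_of_pos hy.1, hy.1.le]
  refine hφi.integral_prod_left.congr ?_
  filter_upwards [ae_restrict_mem measurableSet_Ioo] with x hx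
  have : (fun y => φ (x, y)) = (Ioi x).indicator fun y => |h y| := by
    ext y; simp [hφ, indicator]
  rw [this, integral_indicator measurableSet_Ioi, hμ, Measure.restrict_restrict
    measurableSet_Ioi, show Ioi x ∩ Ioo 0 1 = Ioo x 1 by
      ext z; simp only [mem_inter_iff, mem_Ioi, mem_Ioo]; grind]

lemma pow_mul_supAbsOn_le {f g : ℝ → ℝ} (hfg : ∀ x, 0 < x → HasDerivAt f (g x) x)
    (hg : ContinuousOn g (Ioi 0)) (n : ℕ) {x : ℝ} (hx : 0 < x) :
    x ^ n * supAbsOn f (Ioo x 1) ≤ x ^ n * |f 1| + ∫ y in Ioo x 1, |y ^ n * g y| := by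
  have hxn : 0 < x ^ n := pow_pos hx n
  have hI : 0 ≤ ∫ y in Ioo x 1, |y ^ n * g y| := integral_nonneg fun _ => abs_nonneg _
  rw [mul_comm, ← le_div_iff₀ hxn]
  refine supAbsOn_le (by positivity) fun z hz => ?_
  rw [le_div_iff₀ hxn, mul_comm]
  have hpos : ∀ y ∈ Icc x 1, 0 < y := fun y hy => hx.trans_le hy.1
  have hgx : ContinuousOn g (Icc x 1) := hg.mono hpos
  have hzx : Icc z 1 ⊆ Icc x 1 := Icc_subset_Icc_left hz.1.le
  have hint : IntegrableOn (fun y => |y ^ n * g y|) (Ioo x 1) :=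
    (ContinuousOn.integrableOn_Icc (by fun_prop)).mono_set Ioo_subset_Icc_self
  have hintg : IntegrableOn g (Icc x 1) := hgx.integrableOn_Icc
  have hsub : Ioo z 1 ⊆ Ioo x 1 := Ioo_subset_Ioo_left hz.1.le
  have hftc : ∫ y in Ioo z 1, g y = f 1 - f z := by
    rw [← intervalIntegral.integral_eq_sub_of_hasDerivAt (f := f) (f' := g),
      intervalIntegral.integral_of_le hz.2.le, integral_Ioc_eq_integral_Ioo]
    · intro y hy
      rw [uIcc_of_le hz.2.le] at hy
      exact hfg y (hpos y (hzx hy))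
    · rw [intervalIntegrable_iff_integrableOn_Ioc_of_le hz.2.le]
      exact hintg.mono_set (Ioc_subset_Icc_self.trans hzx)
  have hgabs : IntegrableOn (fun y => |g y|) (Ioo z 1) :=
    (hintg.mono_set (Ioo_subset_Icc_self.trans hzx)).norm
  have hdiff : x ^ n * |f 1 - f z| ≤ ∫ y in Ioo x 1, |y ^ n * g y| :=
    calc x ^ n * |f 1 - f z| ≤ x ^ n * ∫ y in Ioo z 1, |g y| := by
          rw [← hftc]
          gcongr
          exact norm_integral_le_integral_norm g
      _ = ∫ y in Ioo z 1, x ^ n * |g y| := (integral_const_mul _ _).symm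
      _ ≤ ∫ y in Ioo z 1, |y ^ n * g y| := by
          refine setIntegral_mono_on (hgabs.const_mul _) (hint.mono_set hsub)
            measurableSet_Ioo fun y hy => ?_
          have hxy : x ≤ y := (hz.1.trans hy.1).le
          rw [abs_mul, abs_of_pos (pow_pos (hx.trans_le hxy) n)]
          gcongr
      _ ≤ ∫ y in Ioo x 1, |y ^ n * g y| :=
          setIntegral_mono_set hint (Eventually.of_forall fun _ => abs_nonneg _)
            hsub.eventuallyLE
  have htri : |f z| ≤ |f 1| + |f 1 - f z| := by
    rw [abs_sub_comm]
    calc |f z| = |f 1 + (f z - f 1)| := by ring_nf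
      _ ≤ _ := abs_add_le _ _
  calc x ^ n * |f z| ≤ x ^ n * (|f 1| + |f 1 - f z|) := by gcongr
    _ ≤ _ := by rw [mul_add]; gcongr

lemma aestronglyMeasurable_pow_mul_supAbsOn {f : ℝ → ℝ} (hf : ContinuousOn f (Ioi 0)) (n : ℕ) :
    AEStronglyMeasurable (fun x => x ^ n * supAbsOn f (Ioo x 1))
      (volume.restrict (Ioo 0 1)) :=
  (continuous_pow n).aestronglyMeasurable.mul
    (aemeasurable_restrict_of_antitoneOn measurableSet_Ioo
      ((supAbsOn_Ioo_antitoneOn hf 1).mono Ioo_subset_Ioi_self)).aestronglyMeasurable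

lemma integrableOn_pow_mul_supAbsOn {f g : ℝ → ℝ} (hfg : ∀ x, 0 < x → HasDerivAt f (g x) x)
    (hg : ContinuousOn g (Ioi 0)) (n : ℕ)
    (hi : IntegrableOn (fun x => x ^ (n + 1) * g x) (Ioo 0 1)) :
    IntegrableOn (fun x => x ^ n * supAbsOn f (Ioo x 1)) (Ioo 0 1) := by
  have hf : ContinuousOn f (Ioi 0) := fun x hx => (hfg x hx).continuousAt.continuousWithinAt
  have hpow : IntegrableOn (fun x : ℝ => x ^ n * |f 1|) (Ioo 0 1) :=
    (Continuous.integrableOn_Icc (by fun_prop)).mono_set Ioo_subset_Icc_self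
  have htail : IntegrableOn (fun x => ∫ y in Ioo x 1, |y ^ n * g y|) (Ioo 0 1) :=
    integrableOn_tail_integral (by fun_prop) (hi.congr_fun (fun x _ => by ring) measurableSet_Ioo)
  refine (hpow.add htail).mono' (aestronglyMeasurable_pow_mul_supAbsOn hf n) ?_
  filter_upwards [ae_restrict_mem measurableSet_Ioo] with x hx
  rw [Real.norm_of_nonneg (mul_nonneg (pow_nonneg hx.1.le n) (supAbsOn_nonneg _ _))]
  exact pow_mul_supAbsOn_le hfg hg n hx.1

lemma integrableOn_pow_mul_of_supAbsOn {f : ℝ → ℝ} (hf : ContinuousOn f (Ioi 0)) (n : ℕ)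
    (hi : IntegrableOn (fun x => x ^ n * supAbsOn f (Ioo x 1)) (Ioo 0 1)) :
    IntegrableOn (fun x => x ^ n * f x) (Ioo 0 1) := by
  have hfm : ContinuousOn f (Ioo 0 1) := hf.mono Ioo_subset_Ioi_self
  refine hi.mono' (ContinuousOn.aestronglyMeasurable (by fun_prop) measurableSet_Ioo) ?_
  filter_upwards [ae_restrict_mem measurableSet_Ioo] with x hx
  have hx0 := hx.1
  rw [norm_mul, Real.norm_of_nonneg (by positivity)]
  gcongr
  exact abs_left_le_supAbsOn_Ioo hf hx.1 hx.2

lemma tendsto_pow_succ_mul_of_antitoneOn {F : ℝ → ℝ} (hF : AntitoneOn F (Ioi 0))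
    (hF0 : ∀ x, 0 ≤ F x) (n : ℕ) (hi : IntegrableOn (fun x => x ^ n * F x) (Ioo 0 1)) :
    Tendsto (fun x => x ^ (n + 1) * F x) (𝓝[>] 0) (𝓝 0) := by
  have htail : Tendsto (fun x : ℝ => ∫ y in Ioo 0 x, y ^ n * F y) (𝓝[>] 0) (𝓝 0) := by
    have hmeas : Tendsto (fun x : ℝ => volume.restrict (Ioo 0 1) (Ioo 0 x)) (𝓝[>] 0) (𝓝 0) := by
      have h0 : Tendsto (fun x : ℝ => ENNReal.ofReal x) (𝓝[>] 0) (𝓝 0) := by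
        simpa using (ENNReal.continuous_ofReal.tendsto 0).mono_left nhdsWithin_le_nhds
      refine tendsto_of_tendsto_of_tendsto_of_le_of_le tendsto_const_nhds h0
        (fun _ => zero_le) fun x => ?_
      exact (Measure.restrict_apply_le _ _).trans (by simp)
    refine (hi.tendsto_setIntegral_nhds_zero hmeas).congr' ?_
    filter_upwards [Ioo_mem_nhdsGT (zero_lt_one' ℝ)] with x hx
    rw [Measure.restrict_restrict measurableSet_Ioo,
      inter_eq_left.2 (Ioo_subset_Ioo_right hx.2.le)]
  have hbound := htail.const_mul (2 ^ (n + 1) : ℝ)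
  rw [mul_zero] at hbound
  refine tendsto_of_tendsto_of_tendsto_of_le_of_le' tendsto_const_nhds hbound ?_ ?_
  · filter_upwards [self_mem_nhdsWithin] with x hx
    exact mul_nonneg (pow_nonneg (le_of_lt hx) _) (hF0 x)
  · filter_upwards [Ioo_mem_nhdsGT (zero_lt_one' ℝ)] with x hx
    have hx0 := hx.1
    have hix : IntegrableOn (fun y => y ^ n * F y) (Ioo 0 x) :=
      hi.mono_set (Ioo_subset_Ioo_right hx.2.le)
    have hsub : Ioo (x / 2) x ⊆ Ioo 0 x := Ioo_subset_Ioo_left (by positivity)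
    have hlow : (x / 2) ^ (n + 1) * F x ≤ ∫ y in Ioo 0 x, y ^ n * F y :=
      calc (x / 2) ^ (n + 1) * F x = ∫ _ in Ioo (x / 2) x, (x / 2) ^ n * F x := by
            rw [setIntegral_const, Real.volume_real_Ioo_of_le (by linarith), smul_eq_mul]; ring
        _ ≤ ∫ y in Ioo (x / 2) x, y ^ n * F y := by
            refine setIntegral_mono_on (integrableOn_const (by simp)) (hix.mono_set hsub)
              measurableSet_Ioo fun y hy => ?_
            have hy0 : 0 < y := (hsub hy).1
            have h1 := hF hy0 hx0 hy.2.le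
            have h2 := hF0 x
            have h3 := hy.1.le
            gcongr
        _ ≤ _ := by
            refine setIntegral_mono_set hix ?_ hsub.eventuallyLE
            filter_upwards [ae_restrict_mem measurableSet_Ioo] with y hy
            exact mul_nonneg (pow_nonneg hy.1.le n) (hF0 y)
    calc x ^ (n + 1) * F x = 2 ^ (n + 1) * ((x / 2) ^ (n + 1) * F x) := by
          rw [div_pow]; field_simp
      _ ≤ _ := by gcongr

lemma tendsto_pow_succ_mul_supAbsOn {f : ℝ → ℝ} (hf : ContinuousOn f (Ioi 0)) (n : ℕ)
    (hi : IntegrableOn (fun x => x ^ n * supAbsOn f (Ioo x 1)) (Ioo 0 1)) (C : ℝ) :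
    Tendsto (fun x => x ^ (n + 1) * supAbsOn f (Ioo x C)) (𝓝[>] 0) (𝓝 0) := by
  have h1 := tendsto_pow_succ_mul_of_antitoneOn (supAbsOn_Ioo_antitoneOn hf 1)
    (fun _ => supAbsOn_nonneg _ _) n hi
  set M := supAbsOn f (Ioo (1 / 2) C)
  have h2 : Tendsto (fun x : ℝ => x ^ (n + 1) * M) (𝓝[>] 0) (𝓝 0) := by
    have hc : Continuous fun x : ℝ => x ^ (n + 1) * M := by fun_prop
    simpa using (hc.tendsto 0).mono_left nhdsWithin_le_nhds
  have h3 := h1.add h2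
  rw [add_zero] at h3
  refine tendsto_of_tendsto_of_tendsto_of_le_of_le' tendsto_const_nhds h3 ?_ ?_
  · filter_upwards [self_mem_nhdsWithin] with x hx
    exact mul_nonneg (pow_nonneg (le_of_lt hx) _) (supAbsOn_nonneg _ _)
  · filter_upwards [self_mem_nhdsWithin] with x (hx : 0 < x)
    rw [← mul_add]
    gcongr
    have hM : 0 ≤ M := supAbsOn_nonneg _ _
    have hS := supAbsOn_nonneg f (Ioo x 1)
    refine supAbsOn_le (by positivity) fun y hy => ?_
    rcases lt_or_ge y 1 with hy1 | hy1
    · linarith [abs_le_supAbsOn_Ioo hf hx (⟨hy.1, hy1⟩ : y ∈ Ioo x 1)]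
    · linarith [abs_le_supAbsOn_Ioo hf one_half_pos
        (⟨by linarith, hy.2⟩ : y ∈ Ioo (1 / 2) C)]

lemma tendsto_mul_tail_integral {G : ℝ → ℝ}
    (hi : IntegrableOn (fun y => y ^ 2 * G y) (Ioo 0 1)) :
    Tendsto (fun x => x * ∫ y in Ioo x 1, y * G y) (𝓝[>] 0) (𝓝 0) := by
  set φ : ℝ → ℝ → ℝ := fun x => (Ioi x).indicator fun y => x / y * (y ^ 2 * G y) with hφ
  have hlim : Tendsto (fun x => ∫ y in Ioo 0 1, φ x y) (𝓝[>] 0)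
      (𝓝 (∫ _ in Ioo (0 : ℝ) 1, (0 : ℝ))) := by
    refine tendsto_integral_filter_of_dominated_convergence
      (fun y => ‖y ^ 2 * G y‖) ?_ ?_ hi.norm ?_
    · refine Eventually.of_forall fun x => ?_
      refine AEStronglyMeasurable.indicator ?_ measurableSet_Ioi
      exact (measurable_const.div measurable_id).aestronglyMeasurable.mul hi.aestronglyMeasurable
    · filter_upwards [self_mem_nhdsWithin] with x (hx : 0 < x)
      refine Eventually.of_forall fun y => ?_
      by_cases hy : x < y
      · have hy0 := hx.trans hy
        rw [hφ]
        simp only [indicator_of_mem (mem_Ioi.2 hy)]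
        rw [norm_mul, Real.norm_of_nonneg (by positivity)]
        exact mul_le_of_le_one_left (norm_nonneg _) ((div_le_one hy0).2 hy.le)
      · simp only [hφ, indicator_of_notMem (notMem_Ioi.2 (not_lt.1 hy)), norm_zero, norm_nonneg]
    · filter_upwards [ae_restrict_mem measurableSet_Ioo] with y hy
      have hc : Tendsto (fun x : ℝ => x / y * (y ^ 2 * G y)) (𝓝[>] 0) (𝓝 0) := by
        have : Continuous fun x : ℝ => x / y * (y ^ 2 * G y) := by fun_prop
        simpa using (this.tendsto 0).mono_left nhdsWithin_le_nhds
      refine hc.congr' ?_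
      filter_upwards [Ioo_mem_nhdsGT hy.1] with x hx
      simp [hφ, hx.2]
  rw [integral_zero] at hlim
  refine hlim.congr' ?_
  filter_upwards [self_mem_nhdsWithin] with x (hx : 0 < x)
  rw [hφ, integral_indicator measurableSet_Ioi, Measure.restrict_restrict measurableSet_Ioi,
    show Ioi x ∩ Ioo 0 1 = Ioo x 1 by
      ext z; simp only [mem_inter_iff, mem_Ioi, mem_Ioo]; grind, ← integral_const_mul]
  refine setIntegral_congr_fun measurableSet_Ioo fun y hy => ?_
  have hy0 : y ≠ 0 := (hx.trans hy.1).ne'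
  field_simp

/-- Corollary 4.2: consequences of the singularity assumption (regime `m = 1`). `V` is `C³`
on `(0,∞)` (encoded via the derivative family `Vd`, `Vd 0 = V`), `𝕍_ℓ^C(x)` is
`supAbsOn (Vd ℓ) (Ioo x C)`, and `x ↦ x³ 𝕍₃¹(x)` is integrable on `(0,1)`. -/
theorem stmt9 (V : ℝ → ℝ) (Vd : ℕ → ℝ → ℝ)
    (hVd0 : Vd 0 = V)
    (hderiv : ∀ ℓ < 3, ∀ x : ℝ, 0 < x → HasDerivAt (Vd ℓ) (Vd (ℓ + 1) x) x)
    (hcont : ContinuousOn (Vd 3) (Set.Ioi 0))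
    (hint : MeasureTheory.IntegrableOn
      (fun x : ℝ => x ^ 3 * supAbsOn (Vd 3) (Set.Ioo x 1)) (Set.Ioo 0 1)) :
    (∀ k ≤ 2, MeasureTheory.IntegrableOn
      (fun x : ℝ => x ^ k * Vd k x) (Set.Ioo 0 1)) ∧
    (∀ C : ℝ, 0 < C → ∀ k ≤ 2,
      Filter.Tendsto (fun x : ℝ => x ^ (k + 1) * supAbsOn (Vd k) (Set.Ioo x C))
        (nhdsWithin 0 (Set.Ioi 0)) (nhds 0)) ∧
    Filter.Tendsto
      (fun x : ℝ => x * ∫ y in Set.Ioo x 1, y * supAbsOn (Vd 2) (Set.Ioo y 1))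
      (nhdsWithin 0 (Set.Ioi 0)) (nhds 0) := by
  have hc : ∀ k ≤ 3, ContinuousOn (Vd k) (Ioi 0) := by
    intro k hk
    rcases hk.lt_or_eq with h | rfl
    · exact fun x hx => (hderiv k h x hx).continuousAt.continuousWithinAt
    · exact hcont
  have hstep : ∀ k < 3, IntegrableOn (fun x => x ^ (k + 1) * supAbsOn (Vd (k + 1)) (Ioo x 1))
      (Ioo 0 1) → IntegrableOn (fun x => x ^ k * supAbsOn (Vd k) (Ioo x 1)) (Ioo 0 1) :=
    fun k hk h => integrableOn_pow_mul_supAbsOn (hderiv k hk) (hc (k + 1) hk) k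
      (integrableOn_pow_mul_of_supAbsOn (hc (k + 1) hk) (k + 1) h)
  have h2 := hstep 2 (by norm_num) hint
  have h1 := hstep 1 (by norm_num) h2
  have h0 := hstep 0 (by norm_num) h1
  have hsup : ∀ k ≤ 2, IntegrableOn (fun x => x ^ k * supAbsOn (Vd k) (Ioo x 1)) (Ioo 0 1) := by
    intro k hk
    interval_cases k
    exacts [h0, h1, h2]
  exact ⟨fun k hk => integrableOn_pow_mul_of_supAbsOn (hc k (by omega)) k (hsup k hk),
    fun C _ k hk => tendsto_pow_succ_mul_supAbsOn (hc k (by omega)) k (hsup k hk) C,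
    tendsto_mul_tail_integral h2⟩
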